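/- If V is a commutative combinatorial semigroup variety, then V = C_m ∨ N for some integer m ≥ 0 and some nil-variety N. -/

import Mathlib

open FirstOrder

/-! ### Words, identities, and commutative semigroup varieties -/

/-- Semigroup words over the countable alphabet `ℕ`. -/
abbrev SGWord : Type := FreeSemigroup ℕ

/-- A semigroup identity `u = v` is a pair of words. -/
abbrev SGId : Type := SGWord × SGWord

/-- The one-letter word consisting of the letter `n`. -/
def ltr (n : ℕ) : SGWord := FreeSemigroup.of n

/-- `wpow w n` is the word `w^n` (for `n ≥ 1`; by convention `wpow w 0 = w`). -/
def wpow (w : SGWord) : ℕ → SGWord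
  | 0 => w
  | 1 => w
  | n + 2 => wpow w (n + 1) * w

/-- The letter `n` occurs in the word `w`. -/
def OccursIn (n : ℕ) (w : SGWord) : Prop := n = w.head ∨ n ∈ w.tail

/-- A semigroup `S` satisfies the identity `i.1 = i.2` if all evaluations of the two
words in `S` coincide. -/
def SGSatisfies (S : Type) [Semigroup S] (i : SGId) : Prop :=
  ∀ f : ℕ → S, FreeSemigroup.lift f i.1 = FreeSemigroup.lift f i.2

/-- A bundled (nonempty) commutative semigroup. -/
structure ComSG where
  carrier : Type
  [str : CommSemigroup carrier]
  [instNonempty : Nonempty carrier]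

attribute [instance] ComSG.str ComSG.instNonempty

/-- The class of commutative semigroups satisfying every identity in `E`. -/
def modelsOf (E : Set SGId) : Set ComSG := {S | ∀ i ∈ E, SGSatisfies S.carrier i}

/-- The set of identities holding in every member of the class `K`. -/
def theoryOfClass (K : Set ComSG) : Set SGId := {i | ∀ S ∈ K, SGSatisfies S.carrier i}

theorem subset_theoryOfClass_modelsOf (E : Set SGId) : E ⊆ theoryOfClass (modelsOf E) :=
  fun i hi S hS => hS i hi

theorem theoryOfClass_antitone {K K' : Set ComSG} (h : K ⊆ K') :
    theoryOfClass K' ⊆ theoryOfClass K := fun _ hi S hS => hi S (h hS)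

theorem modelsOf_antitone {E E' : Set SGId} (h : E ⊆ E') : modelsOf E' ⊆ modelsOf E :=
  fun _ hS i hi => hS i (h hi)

/-- A variety of commutative semigroups, identified with its (equationally closed)
equational theory.  Varieties are ordered by inclusion of the corresponding classes
of semigroups, i.e. by *reverse* inclusion of theories. -/
structure ComVariety where
  theory : Set SGId
  closed : theoryOfClass (modelsOf theory) = theory

theorem ComVariety.ext' {V W : ComVariety} (h : V.theory = W.theory) : V = W := by
  cases V; cases W; cases h; rfl

instance : PartialOrder ComVariety where
  le V W := W.theory ⊆ V.theory
  le_refl V := subset_rfl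
  le_trans U V W h1 h2 := fun i hi => h1 (h2 hi)
  le_antisymm V W h1 h2 := ComVariety.ext' (subset_antisymm h2 h1)

instance : SupSet ComVariety where
  sSup s :=
    { theory := ⋂ V ∈ s, V.theory
      closed := by
        apply subset_antisymm
        · intro i hi
          refine Set.mem_iInter₂.2 fun V hV => ?_
          have h1 : (⋂ V ∈ s, ComVariety.theory V) ⊆ V.theory := Set.biInter_subset_of_mem hV
          have h2 := theoryOfClass_antitone (modelsOf_antitone h1)
          rw [V.closed] at h2
          exact h2 hi
        · exact subset_theoryOfClass_modelsOf _ }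

/-- The lattice **Com** of all commutative semigroup varieties. -/
instance : CompleteLattice ComVariety :=
  completeLatticeOfSup ComVariety fun s => by
    constructor
    · intro V hV i hi
      exact Set.mem_iInter₂.1 hi V hV
    · intro W hW i hi
      exact Set.mem_iInter₂.2 fun V hV => hW hV hi

/-- The variety of commutative semigroups given by the identity system `E`. -/
def comVar (E : Set SGId) : ComVariety where
  theory := theoryOfClass (modelsOf E)
  closed := by
    apply subset_antisymm
    · exact theoryOfClass_antitone fun S hS i hi => hi S hS
    · exact subset_theoryOfClass_modelsOf _

/-! ### The first-order language of lattices and definability -/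

/-- The first-order language of lattices: two binary function symbols (`true` for the
join `∨` and `false` for the meet `∧`) and nothing else. -/
def latticeLang : Language where
  Functions := fun n => match n with | 2 => Bool | _ => Empty
  Relations := fun _ => Empty

instance latticeLangStructure (L : Type*) [Lattice L] : latticeLang.Structure L where
  funMap {n} f x :=
    match n, f with
    | 2, b => bif b then x 0 ⊔ x 1 else x 0 ⊓ x 1
    | 0, f => f.elim
    | 1, f => f.elim
    | (_ + 3), f => f.elim
  RelMap {n} r _ := r.elim

/-- A subset `A` of a lattice `L` is definable in `L` if there is a first-order formula
`φ(x)` with one free variable in the language of the lattice operations `∨` and `∧`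
such that for every `a ∈ L`, `φ(a)` holds in `L` if and only if `a ∈ A`. -/
def LatDefinable (L : Type*) [Lattice L] (A : Set L) : Prop :=
  ∃ φ : latticeLang.Formula (Fin 1), ∀ a : L, (φ.Realize fun _ => a) ↔ a ∈ A

/-! ### Named varieties -/

/-- The commutativity identity `xy = yx`. -/
def commId : SGId := (ltr 0 * ltr 1, ltr 1 * ltr 0)

/-- The pair of identities abbreviated by the symbolic identity `w = 0`, namely
`wx = w` and `xw = w`, where `x` is the letter `n` (assumed not to occur in `w`). -/
def zeroId (w : SGWord) (n : ℕ) : Set SGId := {(w * ltr n, w), (ltr n * w, w)}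

/-- `A n = var{xⁿy = y, xy = yx}`, the variety of Abelian groups of exponent dividing `n`. -/
def Avar (n : ℕ) : ComVariety := comVar {(wpow (ltr 0) n * ltr 1, ltr 1), commId}

/-- `SL = var{x² = x, xy = yx}`, the variety of semilattices. -/
def SLvar : ComVariety := comVar {(wpow (ltr 0) 2, ltr 0), commId}

/-- `ZM = var{xy = 0}` (within **Com**), the variety of null semigroups. -/
def ZMvar : ComVariety := comVar ({commId} ∪ zeroId (ltr 0 * ltr 1) 2)

/-- `T = var{x = y}`, the trivial variety. -/
def Tvar : ComVariety := comVar {(ltr 0, ltr 1)}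

/-- `COM`, the variety of all commutative semigroups. -/
def COMvar : ComVariety := comVar {commId}

/-- `C m = var{xᵐ = xᵐ⁺¹, xy = yx}` (the variety generated by the cyclic monoid
`⟨a ∣ aᵐ = aᵐ⁺¹⟩`), with the convention `C 0 = T`. -/
def Cvar : ℕ → ComVariety
  | 0 => Tvar
  | m + 1 => comVar {(wpow (ltr 0) (m + 1), wpow (ltr 0) (m + 2)), commId}

/-- `D m = var{xᵐ = 0, xy = yx}`. -/
def Dvar (m : ℕ) : ComVariety := comVar ({commId} ∪ zeroId (wpow (ltr 0) m) 1)

/-- The word `x₁x₂⋯x_k` (in the letters `0, 1, …, k-1`), for `k ≥ 1`. -/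
def chainWord : ℕ → SGWord
  | 0 => ltr 0
  | 1 => ltr 0
  | k + 2 => chainWord (k + 1) * ltr (k + 1)

/-- `N k = var{x² = x₁x₂⋯x_k = 0, xy = yx}`. -/
def Nvar (k : ℕ) : ComVariety :=
  comVar ({commId} ∪ zeroId (wpow (ltr 0) 2) 1 ∪ zeroId (chainWord k) k)

/-- `N_ω = var{x² = 0, xy = yx}`. -/
def Nomegavar : ComVariety := comVar ({commId} ∪ zeroId (wpow (ltr 0) 2) 1)

/-- `N₃ᶜ = var{xyz = 0, xy = yx}`. -/
def N3cvar : ComVariety := comVar ({commId} ∪ zeroId (ltr 0 * ltr 1 * ltr 2) 3)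

/-! ### Semantic notions -/

/-- A semigroup `S` belongs to the variety `V` if it satisfies every identity of `V`. -/
def VMem (S : Type) [Semigroup S] (V : ComVariety) : Prop :=
  ∀ i ∈ V.theory, SGSatisfies S i

/-- `spow a n` is the power `aⁿ` in a semigroup (for `n ≥ 1`; by convention `spow a 0 = a`). -/
def spow {S : Type} [Semigroup S] (a : S) : ℕ → S
  | 0 => a
  | 1 => a
  | n + 2 => spow a (n + 1) * a

/-- A semigroup is a group. -/
def IsGroupSG (S : Type) [Semigroup S] : Prop :=
  ∃ e : S, (∀ a, e * a = a ∧ a * e = a) ∧ ∀ a, ∃ b, a * b = e ∧ b * a = e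

/-- A semigroup is periodic: every element generates a finite cyclic subsemigroup. -/
def IsPeriodicSG (S : Type) [Semigroup S] : Prop :=
  ∀ a : S, ∃ i j : ℕ, 1 ≤ i ∧ i < j ∧ spow a i = spow a j

/-- A semigroup is a nil-semigroup: it has a zero element and every element has a
power equal to zero. -/
def IsNilSG (S : Type) [Semigroup S] : Prop :=
  ∃ z : S, (∀ a, z * a = z ∧ a * z = z) ∧ ∀ a, ∃ n, 1 ≤ n ∧ spow a n = z

/-- A variety all of whose members are groups. -/
def IsGroupVariety (V : ComVariety) : Prop := ∀ S ∈ modelsOf V.theory, IsGroupSG S.carrier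

/-- A variety all of whose members are periodic semigroups. -/
def IsPeriodicVariety (V : ComVariety) : Prop := ∀ S ∈ modelsOf V.theory, IsPeriodicSG S.carrier

/-- A nil-variety: a variety all of whose members are nil-semigroups. -/
def IsNilVariety (V : ComVariety) : Prop := ∀ S ∈ modelsOf V.theory, IsNilSG S.carrier

/-- A combinatorial variety: all groups in it are trivial. -/
def IsCombinatorial (V : ComVariety) : Prop :=
  ∀ S ∈ modelsOf V.theory, IsGroupSG S.carrier → ∀ a b : S.carrier, a = b

/-- `K` is the variety generated by the semigroup `M` (with explicit semigroup
structure `inst`): the smallest variety containing `M`. -/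
def GeneratedBy (M : Type) (inst : Semigroup M) (K : ComVariety) : Prop :=
  IsLeast {W : ComVariety | ∀ i ∈ W.theory, @SGSatisfies M inst i} K

/-- A neutral element of a lattice. -/
def IsNeutralElt {α : Type*} [Lattice α] (x : α) : Prop :=
  ∀ y z, (x ⊔ y) ⊓ (y ⊔ z) ⊓ (z ⊔ x) = (x ⊓ y) ⊔ (y ⊓ z) ⊔ (z ⊓ x)

/-- A chain variety: a variety whose lattice of subvarieties is a chain. -/
def IsChainVariety (V : ComVariety) : Prop :=
  ∀ W₁ W₂ : ComVariety, W₁ ≤ V → W₂ ≤ V → W₁ ≤ W₂ ∨ W₂ ≤ W₁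

/-- A variety is 0-reduced in **Com** if it is given within `COM` by 0-reduced
identities (identities of the form `w = 0`) only. -/
def IsZeroReduced (V : ComVariety) : Prop :=
  ∃ P : Set (SGWord × ℕ), (∀ p ∈ P, ¬ OccursIn p.2 p.1) ∧
    V = comVar (⋃ p ∈ P, zeroId p.1 p.2)

/-- `ZR V`: the least variety 0-reduced in **Com** that contains `V`. -/
def ZRv (V : ComVariety) : ComVariety := sInf {W : ComVariety | IsZeroReduced W ∧ V ≤ W}

/-! ### Multisets of letters -/

/-- The multiset of letters of a word. -/
def letters (w : SGWord) : Multiset ℕ :=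
  (FreeSemigroup.lift (fun i => Multiplicative.ofAdd ({i} : Multiset ℕ)) w).toAdd

@[simp]
theorem letters_ltr (i : ℕ) : letters (ltr i) = {i} := by
  simp [letters, ltr]

@[simp]
theorem letters_of (i : ℕ) : letters (FreeSemigroup.of i) = {i} := by
  simp [letters]

@[simp]
theorem letters_mul (u v : SGWord) : letters (u * v) = letters u + letters v := by
  simp [letters]

theorem letters_wpow (w : SGWord) (k : ℕ) : letters (wpow w (k + 1)) = (k + 1) • letters w := by
  induction k with
  | zero => simp [wpow]
  | succ k ih => rw [wpow, letters_mul, ih, succ_nsmul (letters w) (k + 1)]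

theorem exists_mem_letters (w : SGWord) : ∃ y, y ∈ letters w := by
  induction w using FreeSemigroup.recOnMul with
  | ih1 x => exact ⟨x, by simp⟩
  | ih2 x y _ hy => exact hy.imp fun z hz => by simp [hz]

theorem count_letters_le_count_lift (σ : ℕ → SGWord) {x y : ℕ} (hy : y ∈ letters (σ x))
    (w : SGWord) :
    (letters w).count x ≤ (letters (FreeSemigroup.lift σ w)).count y := by
  induction w using FreeSemigroup.recOnMul with
  | ih1 z =>
    by_cases h : x = z
    · subst h
      simpa using Multiset.one_le_count_iff_mem.2 hy
    · simp [h]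
  | ih2 u v hu hv =>
    simp only [letters_mul, Multiset.count_add, map_mul] at *
    omega

/-- The value of a multiset of letters in the monoid obtained by adjoining a unit. -/
def letterEval {S : Type} [CommSemigroup S] (f : ℕ → S) (s : Multiset ℕ) : WithOne S :=
  (s.map fun i => (f i : WithOne S)).prod

theorem coe_lift {S : Type} [CommSemigroup S] (f : ℕ → S) (w : SGWord) :
    ((FreeSemigroup.lift f w : S) : WithOne S) = letterEval f (letters w) := by
  induction w using FreeSemigroup.recOnMul with
  | ih1 z => simp [letterEval]
  | ih2 u v hu hv =>
    rw [map_mul, WithOne.coe_mul, hv]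
    rw [hu]
    simp [letterEval]

theorem satisfies_iff {S : Type} [CommSemigroup S] (i : SGId) :
    SGSatisfies S i ↔ ∀ f : ℕ → S, letterEval f (letters i.1) = letterEval f (letters i.2) := by
  simp only [SGSatisfies, ← coe_lift, WithOne.coe_inj]

theorem letterEval_const {S : Type} [CommSemigroup S] (a : S) (s : Multiset ℕ) :
    letterEval (fun _ => a) s = (a : WithOne S) ^ s.card := by
  simp [letterEval]

theorem letterEval_ite {S : Type} [CommSemigroup S] (x : ℕ) (a b : S) (s : Multiset ℕ) :
    letterEval (fun i => if i = x then a else b) s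
      = (a : WithOne S) ^ s.count x * (b : WithOne S) ^ (s.filter (· ≠ x)).card := by
  induction s using Multiset.induction_on with
  | empty => simp [letterEval]
  | cons z s ih =>
    simp only [letterEval, Multiset.map_cons, Multiset.prod_cons] at ih ⊢
    rw [ih]
    by_cases h : z = x
    · subst h
      simp [pow_succ', mul_assoc]
    · simp [h, Ne.symm h, pow_succ', mul_left_comm]

theorem letterEval_eq_pow_mul {S : Type} [CommSemigroup S] (f : ℕ → S) {s t : Multiset ℕ}
    (h : t ≤ s) : ∃ r, letterEval f s = letterEval f t * r := by
  obtain ⟨d, rfl⟩ := Multiset.le_iff_exists_add.1 h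
  exact ⟨letterEval f d, by simp [letterEval]⟩

theorem letterEval_add_of_absorb {S : Type} [CommSemigroup S] (f : ℕ → S) (s d : Multiset ℕ)
    (h : ∀ z ∈ d, (f z : WithOne S) * letterEval f s = letterEval f s) :
    letterEval f (s + d) = letterEval f s := by
  induction d using Multiset.induction_on with
  | empty => simp
  | cons z d ih =>
    have h1 := ih fun y hy => h y (Multiset.mem_cons_of_mem hy)
    rw [Multiset.add_cons]
    calc letterEval f (z ::ₘ (s + d)) = (f z : WithOne S) * letterEval f (s + d) := by
          simp [letterEval]
      _ = letterEval f s := by rw [h1, h z (Multiset.mem_cons_self z d)]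

/-- Two multisets have the same value if each absorbs the letters in which the other
one exceeds it. -/
theorem letterEval_eq_of_absorb {S : Type} [CommSemigroup S] (f : ℕ → S) (s t : Multiset ℕ)
    (hs : ∀ z, s.count z < t.count z → (f z : WithOne S) * letterEval f s = letterEval f s)
    (ht : ∀ z, t.count z < s.count z → (f z : WithOne S) * letterEval f t = letterEval f t) :
    letterEval f s = letterEval f t := by
  have key : s + (t - s) = t + (s - t) := by
    ext z
    simp only [Multiset.count_add, Multiset.count_sub]
    omega
  have mem {s t : Multiset ℕ} {z : ℕ} (hz : z ∈ t - s) : s.count z < t.count z := by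
    have := Multiset.one_le_count_iff_mem.2 hz
    rw [Multiset.count_sub] at this
    omega
  rw [← letterEval_add_of_absorb f s (t - s) fun z hz => hs z (mem hz), key,
    letterEval_add_of_absorb f t (s - t) fun z hz => ht z (mem hz)]

theorem coe_spow {S : Type} [CommSemigroup S] (a : S) (k : ℕ) :
    ((spow a (k + 1) : S) : WithOne S) = (a : WithOne S) ^ (k + 1) := by
  induction k with
  | zero => simp [spow]
  | succ k ih => rw [spow, WithOne.coe_mul, ih, ← pow_succ]

theorem lift_wpow {S : Type} [Semigroup S] (f : ℕ → S) (x k : ℕ) :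
    FreeSemigroup.lift f (wpow (ltr x) (k + 1)) = spow (f x) (k + 1) := by
  induction k with
  | zero => simp [spow, wpow, ltr]
  | succ k ih => rw [wpow, spow, map_mul, ih]; simp [ltr]

/-! ### Equational theories as fully invariant congruences -/

theorem mem_theory_iff (V : ComVariety) (i : SGId) :
    i ∈ V.theory ↔ ∀ S ∈ modelsOf V.theory, SGSatisfies S.carrier i := by
  conv_lhs => rw [← V.closed]
  rfl

/-- A fully invariant congruence containing commutativity is an equational theory. -/
theorem theoryOfClass_modelsOf_con (c : Con SGWord) (hcomm : ∀ u v, c (u * v) (v * u))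
    (hsub : ∀ (σ : ℕ → SGWord) u v, c u v → c (FreeSemigroup.lift σ u) (FreeSemigroup.lift σ v)) :
    theoryOfClass (modelsOf {i | c i.1 i.2}) = {i | c i.1 i.2} := by
  refine subset_antisymm (fun i hi => ?_) (subset_theoryOfClass_modelsOf _)
  let inst : CommSemigroup c.Quotient :=
    { mul_assoc := mul_assoc
      mul_comm := by
        intro a b
        induction a, b using Con.induction_on₂ with
        | H u v => exact (Con.eq c).2 (hcomm u v) }
  have : Nonempty c.Quotient := ⟨(ltr 0 : c.Quotient)⟩
  let Q : ComSG := ⟨c.Quotient⟩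
  have lift_eq (σ : ℕ → SGWord) (w : SGWord) :
      FreeSemigroup.lift (fun n => (σ n : c.Quotient)) w
        = ((FreeSemigroup.lift σ w : SGWord) : c.Quotient) := by
    induction w using FreeSemigroup.recOnMul with
    | ih1 z => simp
    | ih2 u v hu hv => rw [map_mul, map_mul, hu, hv]; rfl
  have hQ : Q ∈ modelsOf {i | c i.1 i.2} := by
    intro j hj f
    have hrep (a : c.Quotient) : ∃ w : SGWord, (w : c.Quotient) = a := Quotient.exists_rep a
    choose σ hσ using fun n => hrep (f n)
    obtain rfl : (fun n => (σ n : c.Quotient)) = f := funext hσ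
    exact (lift_eq σ j.1).trans (((Con.eq c).2 (hsub σ _ _ hj)).trans (lift_eq σ j.2).symm)
  have h := hi Q hQ fun n => ((ltr n : SGWord) : c.Quotient)
  have h' := (lift_eq ltr i.1).symm.trans (h.trans (lift_eq ltr i.2))
  have lift_ltr (w : SGWord) : FreeSemigroup.lift ltr w = w := by
    induction w using FreeSemigroup.recOnMul with
    | ih1 z => simp [ltr]
    | ih2 u v hu hv => rw [map_mul, hu, hv]
  rw [lift_ltr, lift_ltr] at h'
  exact (Con.eq c).1 h'

namespace ComVariety

/-- The fully invariant congruence of a variety. -/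
def con (V : ComVariety) : Con SGWord where
  r u v := (u, v) ∈ V.theory
  iseqv :=
    { refl := fun u => (mem_theory_iff V _).2 fun _ _ _ => rfl
      symm := fun h => (mem_theory_iff V _).2 fun S hS f => (hS _ h f).symm
      trans := fun h h' => (mem_theory_iff V _).2 fun S hS f => (hS _ h f).trans (hS _ h' f) }
  mul' h h' := (mem_theory_iff V _).2 fun S hS f => by
    have h1 := hS _ h f
    have h2 := hS _ h' f
    simp only [map_mul] at h1 h2 ⊢
    rw [h1, h2]

theorem con_mul_comm (V : ComVariety) (u v : SGWord) : V.con (u * v) (v * u) :=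
  (mem_theory_iff V _).2 fun S _ f => by simp only [map_mul]; exact mul_comm _ _

theorem con_lift (V : ComVariety) (σ : ℕ → SGWord) (u v : SGWord) (h : V.con u v) :
    V.con (FreeSemigroup.lift σ u) (FreeSemigroup.lift σ v) :=
  (mem_theory_iff V _).2 fun S hS f => by
    have key (w : SGWord) : FreeSemigroup.lift f (FreeSemigroup.lift σ w)
        = FreeSemigroup.lift (fun n => FreeSemigroup.lift f (σ n)) w := by
      induction w using FreeSemigroup.recOnMul with
      | ih1 z => simp
      | ih2 u v hu hv => simp only [map_mul, hu, hv]
    rw [key, key]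
    exact hS _ h _

/-- Words equivalent in `V` to a word in which some letter occurs at least `n` times. -/
def nilIdeal (V : ComVariety) (n : ℕ) : Set SGWord :=
  {u | ∃ u', V.con u u' ∧ ∃ x, n ≤ (letters u').count x}

theorem mul_mem_nilIdeal {V : ComVariety} {n : ℕ} {u : SGWord} (hu : u ∈ V.nilIdeal n)
    (w : SGWord) : u * w ∈ V.nilIdeal n := by
  obtain ⟨u', h, x, hx⟩ := hu
  exact ⟨u' * w, V.con.mul h (V.con.refl w), x, by simp; omega⟩

theorem nilIdeal_of_con {V : ComVariety} {n : ℕ} {u v : SGWord} (h : V.con u v)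
    (hv : v ∈ V.nilIdeal n) : u ∈ V.nilIdeal n := by
  obtain ⟨v', h', hx⟩ := hv
  exact ⟨v', V.con.trans h h', hx⟩

theorem mul_mem_nilIdeal' {V : ComVariety} {n : ℕ} {u : SGWord} (hu : u ∈ V.nilIdeal n)
    (w : SGWord) : w * u ∈ V.nilIdeal n :=
  nilIdeal_of_con (V.con_mul_comm w u) (mul_mem_nilIdeal hu w)

theorem lift_mem_nilIdeal {V : ComVariety} {n : ℕ} {u : SGWord} (hu : u ∈ V.nilIdeal n)
    (σ : ℕ → SGWord) : FreeSemigroup.lift σ u ∈ V.nilIdeal n := by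
  obtain ⟨u', h, x, hx⟩ := hu
  obtain ⟨y, hy⟩ := exists_mem_letters (σ x)
  exact ⟨_, V.con_lift σ _ _ h, y, hx.trans (count_letters_le_count_lift σ hy u')⟩

/-- The congruence of `V` with the ideal `V.nilIdeal n` collapsed. -/
def nilCon (V : ComVariety) (n : ℕ) : Con SGWord where
  r u v := V.con u v ∨ u ∈ V.nilIdeal n ∧ v ∈ V.nilIdeal n
  iseqv :=
    { refl := fun u => Or.inl (V.con.refl u)
      symm := fun h => h.imp V.con.symm And.symm
      trans := by
        rintro u v w (h | h) (h' | h')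
        · exact Or.inl (V.con.trans h h')
        · exact Or.inr ⟨nilIdeal_of_con h h'.1, h'.2⟩
        · exact Or.inr ⟨h.1, nilIdeal_of_con (V.con.symm h') h.2⟩
        · exact Or.inr ⟨h.1, h'.2⟩ }
  mul' := by
    rintro u v w z (h | h) (h' | h')
    · exact Or.inl (V.con.mul h h')
    · exact Or.inr ⟨mul_mem_nilIdeal' h'.1 _, mul_mem_nilIdeal' h'.2 _⟩
    · exact Or.inr ⟨mul_mem_nilIdeal h.1 _, mul_mem_nilIdeal h.2 _⟩
    · exact Or.inr ⟨mul_mem_nilIdeal h.1 _, mul_mem_nilIdeal h.2 _⟩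

/-- The subvariety of `V` defined by `xⁿ = 0`. -/
def nilPart (V : ComVariety) (n : ℕ) : ComVariety where
  theory := {i | V.nilCon n i.1 i.2}
  closed := theoryOfClass_modelsOf_con _ (fun u v => Or.inl (V.con_mul_comm u v))
    fun σ u v h => h.imp (V.con_lift σ u v)
      fun h => ⟨lift_mem_nilIdeal h.1 σ, lift_mem_nilIdeal h.2 σ⟩

theorem nilPart_le (V : ComVariety) (n : ℕ) : V.nilPart n ≤ V := fun _ hi => Or.inl hi

theorem isNilVariety_nilPart (V : ComVariety) (n : ℕ) : IsNilVariety (V.nilPart (n + 1)) := by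
  intro S hS
  have hpow (x : ℕ) : wpow (ltr x) (n + 1) ∈ V.nilIdeal (n + 1) :=
    ⟨_, V.con.refl _, x, by simp [letters_wpow]⟩
  have hz (a b : S.carrier) : spow a (n + 1) * b = spow a (n + 1) := by
    have := hS (wpow (ltr 0) (n + 1) * ltr 1, wpow (ltr 0) (n + 1))
      (Or.inr ⟨mul_mem_nilIdeal (hpow 0) _, hpow 0⟩) fun i => if i = 0 then a else b
    rw [map_mul, lift_wpow] at this
    simpa [ltr] using this
  have he (a b : S.carrier) : spow a (n + 1) = spow b (n + 1) := by
    have := hS (wpow (ltr 0) (n + 1), wpow (ltr 1) (n + 1))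
      (Or.inr ⟨hpow 0, hpow 1⟩) fun i => if i = 0 then a else b
    simpa [lift_wpow] using this
  obtain ⟨e⟩ := S.instNonempty
  exact ⟨spow e (n + 1), fun a => ⟨hz e a, (mul_comm _ _).trans (hz e a)⟩,
    fun a => ⟨n + 1, by omega, he a e⟩⟩

/-! ### Combinatorial varieties are aperiodic -/

/-- The group of periods: differences `p - q` for which `V` satisfies `xᵖ = x^q`. -/
def periods (V : ComVariety) : AddSubgroup ℤ where
  carrier := {d | ∃ p q : ℕ, (p : ℤ) - q = d ∧
    ∀ S ∈ modelsOf V.theory, ∀ a : S.carrier, (a : WithOne S.carrier) ^ p = (a : WithOne _) ^ q}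
  zero_mem' := ⟨0, 0, by simp, fun _ _ _ => rfl⟩
  add_mem' := by
    rintro _ _ ⟨p, q, rfl, h⟩ ⟨p', q', rfl, h'⟩
    refine ⟨p + p', q + q', by push_cast; ring, fun S hS a => ?_⟩
    rw [pow_add, pow_add, h S hS, h' S hS]
  neg_mem' := by
    rintro _ ⟨p, q, rfl, h⟩
    exact ⟨q, p, by ring, fun S hS a => (h S hS a).symm⟩

theorem count_sub_count_mem_periods {V : ComVariety} {i : SGId} (hi : i ∈ V.theory) (x : ℕ) :
    ((letters i.1).count x : ℤ) - (letters i.2).count x ∈ V.periods := by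
  have split (s : Multiset ℕ) : s.count x + (s.filter (· ≠ x)).card = s.card := by
    conv_rhs => rw [← Multiset.filter_add_not (· = x) s, Multiset.card_add,
      ← Multiset.countP_eq_card_filter]
    simp [Multiset.count, eq_comm]
  have h1 : ((letters i.1).card : ℤ) - (letters i.2).card ∈ V.periods := by
    refine ⟨_, _, rfl, fun S hS a => ?_⟩
    simpa [letterEval_const] using (satisfies_iff i).1 (hS i hi) fun _ => a
  have h2 : (((letters i.1).count x + (letters i.1).card : ℕ) : ℤ)
      - ((letters i.2).count x + (letters i.2).card : ℕ) ∈ V.periods := by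
    refine ⟨_, _, rfl, fun S hS a => ?_⟩
    have := (satisfies_iff i).1 (hS i hi) fun j => if j = x then a * a else a
    simpa only [letterEval_ite, WithOne.coe_mul, ← pow_two, ← pow_mul, ← pow_add, two_mul,
      add_assoc, split] using this
  convert V.periods.sub_mem h2 h1 using 1
  push_cast
  ring

theorem sum_map_eq_of_count {A : Type} [AddCommGroup A] (g : ℕ → A) (s t : Multiset ℕ)
    (h : ∀ x, s.count x • g x = t.count x • g x) : (s.map g).sum = (t.map g).sum := by
  have key (r : Multiset ℕ) (hr : r.toFinset ⊆ s.toFinset ∪ t.toFinset) :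
      (r.map g).sum = ∑ x ∈ s.toFinset ∪ t.toFinset, r.count x • g x := by
    rw [Finset.sum_multiset_map_count]
    refine Finset.sum_subset hr fun x _ hx => ?_
    rw [Multiset.mem_toFinset] at hx
    simp [Multiset.count_eq_zero_of_notMem hx]
  rw [key s Finset.subset_union_left, key t Finset.subset_union_right]
  exact Finset.sum_congr rfl fun x _ => h x

theorem one_mem_periods {V : ComVariety} (hV : IsCombinatorial V) : (1 : ℤ) ∈ V.periods := by
  let G : ComSG := ⟨Multiplicative (ℤ ⧸ V.periods)⟩
  have lift_eq (f : ℕ → Multiplicative (ℤ ⧸ V.periods)) (w : SGWord) :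
      FreeSemigroup.lift f w
        = Multiplicative.ofAdd ((letters w).map fun i => (f i).toAdd).sum := by
    induction w using FreeSemigroup.recOnMul with
    | ih1 z => simp
    | ih2 u v hu hv => rw [map_mul, hu, hv]; simp
  have hG : G ∈ modelsOf V.theory := by
    intro i hi f
    refine (lift_eq f i.1).trans (Eq.trans ?_ (lift_eq f i.2).symm)
    congr 1
    refine sum_map_eq_of_count _ _ _ fun x => ?_
    obtain ⟨k, hk⟩ := QuotientAddGroup.mk_surjective (Multiplicative.toAdd (f x))
    rw [← hk, ← QuotientAddGroup.mk_nsmul, ← QuotientAddGroup.mk_nsmul, QuotientAddGroup.eq]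
    have := V.periods.zsmul_mem (count_sub_count_mem_periods hi x) (-k)
    convert this using 1
    simp only [nsmul_eq_mul, smul_eq_mul]
    ring
  have hgrp : IsGroupSG (Multiplicative (ℤ ⧸ V.periods)) :=
    ⟨1, fun a => ⟨one_mul a, mul_one a⟩, fun a => ⟨a⁻¹, mul_inv_cancel a, inv_mul_cancel a⟩⟩
  have h : Multiplicative.ofAdd ((1 : ℤ) : ℤ ⧸ V.periods) = Multiplicative.ofAdd 0 :=
    hV G hG hgrp _ _
  exact (QuotientAddGroup.eq_zero_iff (1 : ℤ)).1 (Multiplicative.ofAdd.injective h)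

theorem exists_pow_succ_eq {V : ComVariety} (hV : IsCombinatorial V) :
    ∃ n : ℕ, ∀ S ∈ modelsOf V.theory, ∀ a : S.carrier,
      (a : WithOne S.carrier) ^ (n + 1) * a = (a : WithOne S.carrier) ^ (n + 1) := by
  obtain ⟨p, q, hpq, h⟩ := one_mem_periods hV
  obtain rfl : p = q + 1 := by omega
  exact ⟨q, fun S hS a => by rw [h S hS a, ← pow_succ, h S hS a]⟩

end ComVariety

theorem pow_eq_of_le {M : Type} [Monoid M] {a : M} {n : ℕ} (h : a ^ n * a = a ^ n) {k : ℕ}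
    (hk : n ≤ k) : a ^ k = a ^ n := by
  induction k, hk using Nat.le_induction with
  | base => rfl
  | succ k _ ih => rw [pow_succ, ih, h]

/-- If multiplying `aⁱ y` by `aʳ` with `r ≥ 1` does not change it, and powers of `a` stabilise,
then `aⁱ y` absorbs `a`. -/
theorem pow_mul_absorb {M : Type} [CommMonoid M] {a y : M} {n i r : ℕ} (h : a ^ n * a = a ^ n)
    (hr : 1 ≤ r) (hi : a ^ i * y = a ^ (i + r) * y) : a * (a ^ i * y) = a ^ i * y := by
  have iter (t : ℕ) : a ^ i * y = a ^ (i + r * t) * y := by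
    induction t with
    | zero => simp
    | succ t ih =>
      rw [ih, show i + r * (t + 1) = r * t + (i + r) by ring, pow_add a (r * t), mul_assoc, ← hi,
        ← mul_assoc, ← pow_add, add_comm]
  have hn : n ≤ i + r * n := by nlinarith
  rw [iter n, pow_eq_of_le h hn, ← mul_assoc, mul_comm a, h]

namespace ComVariety

/-- `V` satisfies `xⁱyⁿ = xⁱ⁺¹yⁿ`. -/
def Absorbs (V : ComVariety) (n i : ℕ) : Prop :=
  ∀ S ∈ modelsOf V.theory, ∀ a b : S.carrier,
    (a : WithOne S.carrier) * ((a : WithOne S.carrier) ^ i * (b : WithOne S.carrier) ^ n)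
      = (a : WithOne S.carrier) ^ i * (b : WithOne S.carrier) ^ n

theorem absorbs_of_count_lt {V : ComVariety} {n : ℕ}
    (hn : ∀ S ∈ modelsOf V.theory, ∀ a : S.carrier,
      (a : WithOne S.carrier) ^ (n + 1) * a = (a : WithOne S.carrier) ^ (n + 1))
    {u v : SGWord} (h : V.con u v) {x : ℕ} (hx : (letters u).count x < (letters v).count x) :
    V.Absorbs (n + 1) ((letters u).count x) := by
  intro S hS a b
  refine pow_mul_absorb (r := (letters v).count x - (letters u).count x) (hn S hS a) (by omega) ?_
  rw [Nat.add_sub_cancel' hx.le]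
  have h1 := (satisfies_iff (u, v)).1 (hS _ h) fun j => if j = x then a else b
  simp only [letterEval_ite] at h1
  have h2 := congrArg (· * (b : WithOne S.carrier) ^ (n + 1)) h1
  simp only [mul_assoc, ← pow_add] at h2
  rwa [pow_eq_of_le (hn S hS b) (Nat.le_add_left (n + 1) _),
    pow_eq_of_le (hn S hS b) (Nat.le_add_left (n + 1) _)] at h2

end ComVariety

/-! ### The varieties `C m` -/

theorem mem_Cvar_theory (m : ℕ) (u v : SGWord)
    (huv : ∀ z, (letters u).count z < (letters v).count z → m ≤ (letters u).count z)
    (hvu : ∀ z, (letters v).count z < (letters u).count z → m ≤ (letters v).count z) :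
    (u, v) ∈ (Cvar m).theory := by
  cases m with
  | zero =>
    intro S hS f
    have h := hS _ (Set.mem_singleton _) fun i =>
      if i = 0 then FreeSemigroup.lift f u else FreeSemigroup.lift f v
    simpa [ltr] using h
  | succ m =>
    intro S hS
    have hpow (a : S.carrier) :
        (a : WithOne S.carrier) ^ (m + 1 + 1) = (a : WithOne S.carrier) ^ (m + 1) := by
      have h := hS _ (Set.mem_insert _ _) fun _ => a
      simp only [lift_wpow] at h
      rw [← coe_spow, ← coe_spow, h]
    have absorb (f : ℕ → S.carrier) (w : SGWord) (z : ℕ) (hz : m + 1 ≤ (letters w).count z) :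
        (f z : WithOne S.carrier) * letterEval f (letters w) = letterEval f (letters w) := by
      obtain ⟨r, hr⟩ := letterEval_eq_pow_mul f (Multiset.le_count_iff_replicate_le.1 hz)
      rw [hr]
      simp only [letterEval, Multiset.map_replicate, Multiset.prod_replicate]
      rw [← mul_assoc, ← pow_succ', hpow]
    rw [satisfies_iff]
    exact fun f => letterEval_eq_of_absorb f _ _ (fun z hz => absorb f u z (huv z hz))
      fun z hz => absorb f v z (hvu z hz)

theorem le_count_of_mem_Cvar_theory {m : ℕ} {u v : SGWord} (h : (u, v) ∈ (Cvar m).theory) {z : ℕ}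
    (hz : (letters u).count z < (letters v).count z) : m ≤ (letters u).count z := by
  cases m with
  | zero => exact Nat.zero_le _
  | succ m =>
  by_contra! hlt
  let P := Submonoid.powers (2 : ZMod (2 ^ (m + 1)))
  have two_pow : (2 : ZMod (2 ^ (m + 1))) ^ (m + 1) = 0 := by
    exact_mod_cast ZMod.natCast_self (2 ^ (m + 1))
  let C : ComSG := ⟨P⟩
  have spow_eq (a : P) (k : ℕ) : spow a (k + 1) = a ^ (k + 1) := by
    induction k with
    | zero => simp [spow]
    | succ k ih => rw [spow, ih, pow_succ a (k + 1)]
  have hC : C ∈ modelsOf {(wpow (ltr 0) (m + 1), wpow (ltr 0) (m + 2)), commId} := by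
    rintro i (rfl | rfl) f
    · refine (lift_wpow f 0 m).trans (Eq.trans ?_ (lift_wpow f 0 (m + 1)).symm)
      refine (spow_eq (f 0) m).trans (Eq.trans ?_ (spow_eq (f 0) (m + 1)).symm)
      generalize hfa : f 0 = a
      obtain ⟨k, hk⟩ := a.2
      refine Subtype.ext ?_
      rw [SubmonoidClass.coe_pow, SubmonoidClass.coe_pow, ← hk]
      cases k with
      | zero => simp
      | succ k =>
        simp only [← pow_mul]
        rw [pow_eq_zero_of_le (by nlinarith) two_pow, pow_eq_zero_of_le (by nlinarith) two_pow]
    · simp only [commId, map_mul]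
      exact mul_comm _ _
  have lift_eq (w : SGWord) :
      ((FreeSemigroup.lift (fun i => if i = z then (⟨2, 1, by simp⟩ : P) else 1) w : P)
        : ZMod (2 ^ (m + 1))) = 2 ^ (letters w).count z := by
    induction w using FreeSemigroup.recOnMul with
    | ih1 y =>
      by_cases hy : y = z
      · simp [hy]
      · simp [hy, Ne.symm hy]
    | ih2 u v hu hv =>
      rw [map_mul, Submonoid.coe_mul, hv]
      rw [hu, ← pow_add, letters_mul, Multiset.count_add]
  have heq : (2 : ZMod (2 ^ (m + 1))) ^ (letters u).count z = 2 ^ (letters v).count z := by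
    rw [← lift_eq u, ← lift_eq v]
    exact congrArg Subtype.val (h C hC _)
  have h2 := congrArg (· * (2 : ZMod (2 ^ (m + 1))) ^ (m - (letters u).count z)) heq
  simp only [← pow_add] at h2
  rw [pow_eq_zero_of_le (by omega : m + 1 ≤ (letters v).count z + _) two_pow,
    Nat.add_sub_cancel' (by omega)] at h2
  have h3 : ((2 ^ m : ℕ) : ZMod (2 ^ (m + 1))) = 0 := by exact_mod_cast h2
  rw [ZMod.natCast_eq_zero_iff, Nat.pow_dvd_pow_iff_le_right (by omega)] at h3
  omega

/-- **Corollary.** If `V` is a commutative combinatorial semigroup variety, then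
`V = C m ∨ N` for some `m ≥ 0` and some nil-variety `N`. -/
theorem combinatorial_decomposition (V : ComVariety) (hV : IsCombinatorial V) :
    ∃ (m : ℕ) (N : ComVariety), IsNilVariety N ∧ V = Cvar m ⊔ N := by
  classical
  obtain ⟨n, hn⟩ := ComVariety.exists_pow_succ_eq hV
  have hex : ∃ i, V.Absorbs (n + 1) i :=
    ⟨n + 1, fun S hS a b => by rw [← mul_assoc, ← pow_succ', pow_succ, hn S hS a]⟩
  obtain ⟨m, hm, hmin⟩ : ∃ m, V.Absorbs (n + 1) m ∧ ∀ i, V.Absorbs (n + 1) i → m ≤ i :=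
    ⟨Nat.find hex, Nat.find_spec hex, fun i hi => Nat.find_min' hex hi⟩
  have hCV : Cvar m ≤ V := fun i hi => mem_Cvar_theory m i.1 i.2
    (fun z hz => hmin _ (ComVariety.absorbs_of_count_lt hn hi hz))
    fun z hz => hmin _ (ComVariety.absorbs_of_count_lt hn (V.con.symm hi) hz)
  refine ⟨m, V.nilPart (n + 1), V.isNilVariety_nilPart n,
    le_antisymm (fun i hi => ?_) (sup_le hCV (V.nilPart_le _))⟩
  have hC : (Cvar m).con i.1 i.2 := (le_sup_left : Cvar m ≤ Cvar m ⊔ V.nilPart (n + 1)) hi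
  obtain h | ⟨⟨u, hu, x, hx⟩, ⟨v, hv, y, hy⟩⟩ :=
    (le_sup_right : V.nilPart (n + 1) ≤ Cvar m ⊔ V.nilPart (n + 1)) hi
  · exact h
  have hCuv : (Cvar m).con u v :=
    (Cvar m).con.trans (hCV ((V.con).symm hu)) ((Cvar m).con.trans hC (hCV hv))
  have absorb (S) (hS : S ∈ modelsOf V.theory) (f : ℕ → S.carrier) (w : SGWord) (x z : ℕ)
      (hx : n + 1 ≤ (letters w).count x) (hz : m ≤ (letters w).count z) :
      (f z : WithOne S.carrier) * letterEval f (letters w) = letterEval f (letters w) := by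
    by_cases hzx : z = x
    · subst hzx
      obtain ⟨r, hr⟩ := letterEval_eq_pow_mul f (Multiset.le_count_iff_replicate_le.1 hx)
      rw [hr]
      simp only [letterEval, Multiset.map_replicate, Multiset.prod_replicate]
      rw [← mul_assoc, ← pow_succ', pow_succ, hn S hS]
    · have hle : Multiset.replicate m z + Multiset.replicate (n + 1) x ≤ letters w := by
        rw [Multiset.le_iff_count]
        intro t
        rw [Multiset.count_add, Multiset.count_replicate, Multiset.count_replicate]
        split_ifs <;> grind
      obtain ⟨r, hr⟩ := letterEval_eq_pow_mul f hle
      rw [hr]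
      simp only [letterEval, Multiset.map_add, Multiset.prod_add, Multiset.map_replicate,
        Multiset.prod_replicate]
      rw [← mul_assoc, hm S hS]
  have huv : V.con u v := (mem_theory_iff V _).2 fun S hS => (satisfies_iff _).2 fun f =>
    letterEval_eq_of_absorb f _ _
      (fun z hz => absorb S hS f u x z hx (le_count_of_mem_Cvar_theory hCuv hz))
      fun z hz => absorb S hS f v y z hy
        (le_count_of_mem_Cvar_theory ((Cvar m).con.symm hCuv) hz)
  exact V.con.trans hu (V.con.trans huv (V.con.symm hv))
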